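/- arXiv:1809.02491 — 6 statements merged into one kernel-verified Lean document; each statement's English description precedes it below -/
import Mathlib

section
/- If X is a nonzero N×N real positive semidefinite matrix with L(X) = 0, where L is the Low-Rank-Functional, then X has rank one. -/
theorem rank_one_of_lrf_eq_zero {N : ℕ} (X : Matrix (Fin N) (Fin N) ℝ)
    (hX : X.PosSemidef) (hne : X ≠ 0)
    (hL : ∑ i : Fin N, ∑ j : Fin N, (X i i * X j j - X i j ^ 2) = 0) :
    X.rank = 1 := by
  have hs : ∀ i j, X j i = X i j := fun i j => by
    simpa using hX.isHermitian.apply i j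
  have h2 : ∀ i j, 0 ≤ X i i * X j j - X i j ^ 2 := fun i j => by
    have h := (hX.submatrix ![i, j]).det_nonneg
    rw [Matrix.det_fin_two] at h
    simp [Matrix.submatrix_apply] at h
    rw [hs i j] at h
    nlinarith
  have h0 : ∀ i j, X i j ^ 2 = X i i * X j j := fun i j => by
    have h := (Finset.sum_eq_zero_iff_of_nonneg
      (fun i _ => Finset.sum_nonneg (fun j _ => h2 i j))).1 hL i (Finset.mem_univ i)
    have h' := (Finset.sum_eq_zero_iff_of_nonneg (fun j _ => h2 i j)).1 h j (Finset.mem_univ j)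
    linarith
  have h3 : ∀ i j k, X i i * X j j * X k k ≤ X i j * X i k * X j k := fun i j k => by
    have h := (hX.submatrix ![i, j, k]).det_nonneg
    rw [Matrix.det_fin_three] at h
    simp [Matrix.submatrix_apply] at h
    rw [hs i j, hs i k, hs j k] at h
    have e1 : X i j ^ 2 * X k k = X i i * X j j * X k k := by rw [h0 i j]
    have e2 : X i k ^ 2 * X j j = X i i * X k k * X j j := by rw [h0 i k]
    have e3 : X j k ^ 2 * X i i = X j j * X k k * X i i := by rw [h0 j k]
    nlinarith
  obtain ⟨k, hk⟩ : ∃ k, X k k ≠ 0 := by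
    by_contra! hc
    apply hne
    ext i j
    have := h0 i j
    rw [hc i] at this
    simpa using this
  have key : ∀ i j, X i j * X k k = X i k * X j k := fun i j => by
    have a := h0 i j
    have b := h0 i k
    have c := h0 j k
    have hsq : (X i j * X k k) ^ 2 = (X i k * X j k) ^ 2 := by
      rw [mul_pow, mul_pow, a, b, c]; ring
    rcases sq_eq_sq_iff_eq_or_eq_neg.1 hsq with h | h
    · exact h
    · have hi := hX.diag_nonneg (i := i)
      have hj := hX.diag_nonneg (i := j)
      have hkk := hX.diag_nonneg (i := k)
      have hp : 0 ≤ X i i * X j j * X k k := by positivity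
      have hq : 0 ≤ (X i j * X i k * X j k) * X k k := mul_nonneg (hp.trans (h3 i j k)) hkk
      have hz : X i k * X j k = 0 := by
        have : (X i j * X i k * X j k) * X k k = - (X i k * X j k) ^ 2 := by
          linear_combination (X i k * X j k) * h
        have := sq_nonneg (X i k * X j k)
        exact pow_eq_zero_iff (two_ne_zero) |>.1 (by linarith)
      rw [h, hz, neg_zero]
  have hv : X = Matrix.vecMulVec (fun i => X i k / X k k) (fun j => X j k) := by
    ext i j
    rw [Matrix.vecMulVec_apply]
    field_simp
    exact key i j
  apply le_antisymm
  · rw [hv]; exact Matrix.rank_vecMulVec_le _ _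
  · rw [Nat.one_le_iff_ne_zero]
    intro h
    rw [Matrix.rank, Submodule.finrank_eq_zero, LinearMap.range_eq_bot] at h
    apply hne
    ext i j
    have := congrFun (LinearMap.congr_fun h (Pi.single j 1)) i
    simpa using this
end

section
/- A nonzero N×N real positive semidefinite matrix X has rank one if and only if L(X) = 0, where L is the Low-Rank-Functional. -/
lemma trace_mul_self_eigs {N : ℕ} (X : Matrix (Fin N) (Fin N) ℝ) (hX : X.IsHermitian) :
    (X * X).trace = ∑ i, hX.eigenvalues i ^ 2 := by
  have h := hX.spectral_theorem
  have h2 : X * X = Unitary.conjStarAlgAut ℝ _ hX.eigenvectorUnitary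
      (Matrix.diagonal (fun i => hX.eigenvalues i ^ 2)) := by
    conv_lhs => rw [h]
    rw [← map_mul, Matrix.diagonal_mul_diagonal]
    congr 2
    ext i
    simp [sq]
  rw [h2, Unitary.conjStarAlgAut_apply, Matrix.trace_mul_cycle, Unitary.coe_star_mul_self,
    one_mul, Matrix.trace_diagonal]

lemma lrf_eigs {N : ℕ} (X : Matrix (Fin N) (Fin N) ℝ) (hX : X.IsHermitian) :
    ∑ i : Fin N, ∑ j : Fin N, (X i i * X j j - X i j ^ 2)
      = ∑ i, hX.eigenvalues i * (∑ j, hX.eigenvalues j - hX.eigenvalues i) := by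
  have h1 := hX.trace_eq_sum_eigenvalues
  have h2 := trace_mul_self_eigs X hX
  have h3 : (X * X).trace = ∑ i, ∑ j, X i j ^ 2 := by
    simp only [Matrix.trace, Matrix.diag, Matrix.mul_apply]
    refine Finset.sum_congr rfl fun i _ => Finset.sum_congr rfl fun j _ => ?_
    have := hX.apply i j
    simp only [star_trivial] at this
    rw [this, sq]
  have h4 : X.trace = ∑ i, hX.eigenvalues i := by simpa using h1
  simp only [Finset.sum_sub_distrib, mul_sub, ← Finset.sum_mul, ← Finset.mul_sum]
  rw [← h3, h2, ← h4]
  simp [Matrix.trace, sq]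

theorem rank_one_iff_lrf_eq_zero {N : ℕ} (X : Matrix (Fin N) (Fin N) ℝ)
    (hX : X.PosSemidef) (hne : X ≠ 0) :
    X.rank = 1 ↔ ∑ i : Fin N, ∑ j : Fin N, (X i i * X j j - X i j ^ 2) = 0 := by
  rw [lrf_eigs X hX.1, hX.1.rank_eq_card_non_zero_eigs, Fintype.card_eq_one_iff]
  have hz : hX.1.eigenvalues ≠ 0 := fun h => hne (hX.1.eigenvalues_eq_zero_iff.mp h)
  have hnn := hX.eigenvalues_nonneg
  generalize hX.1.eigenvalues = d at *
  have hsub : ∀ i, ∑ j, d j - d i = ∑ j ∈ Finset.univ.erase i, d j := fun i => by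
    rw [← Finset.add_sum_erase _ d (Finset.mem_univ i)]; ring
  simp only [hsub]
  rw [Finset.sum_eq_zero_iff_of_nonneg
    (fun i _ => mul_nonneg (hnn i) (Finset.sum_nonneg fun j _ => hnn j))]
  constructor
  · rintro ⟨⟨k, hk⟩, hu⟩ i _
    by_cases hi : d i = 0
    · simp [hi]
    · rw [Finset.sum_eq_zero, mul_zero]
      intro j hj
      by_contra hj0
      have e1 := congrArg Subtype.val (hu ⟨i, hi⟩)
      have e2 := congrArg Subtype.val (hu ⟨j, hj0⟩)
      exact (Finset.mem_erase.mp hj).1 (e2.trans e1.symm)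
  · intro h
    obtain ⟨k, hk⟩ := Function.ne_iff.mp hz
    refine ⟨⟨k, hk⟩, ?_⟩
    rintro ⟨j, hj⟩
    by_contra hjk
    have hs := (mul_eq_zero.mp (h k (Finset.mem_univ k))).resolve_left hk
    rw [Finset.sum_eq_zero_iff_of_nonneg (fun j _ => hnn j)] at hs
    exact hj (hs j (Finset.mem_erase.mpr ⟨fun e => hjk (Subtype.ext e), Finset.mem_univ j⟩))
end

section
/- Let X^(1), …, X^(r) be nonzero N×N real positive semidefinite matrices such that the Particular-Rank-Functional vanishes: P_r(X^(1),…,X^(r)) = Σ_{k=1}^{r} L(X^(k)) + Σ_{p ≠ q} Tr(X^(p) X^(q)) = 0. Then the matrix X = Σ_{k=1}^{r} X^(k) is positive semidefinite and has rank exactly r. -/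
theorem aux_minor {N : ℕ} {A : Matrix (Fin N) (Fin N) ℝ} (hA : A.PosSemidef) (i j : Fin N) :
    0 ≤ A i i * A j j - A i j ^ 2 := by
  have h := (hA.submatrix ![i, j]).det_nonneg
  rw [Matrix.det_fin_two] at h
  have hs : A j i = A i j := by simpa using hA.isHermitian.apply i j
  simp [hs] at h
  nlinarith

theorem aux_trace {N : ℕ} {A B : Matrix (Fin N) (Fin N) ℝ} (hA : A.PosSemidef)
    (hB : B.PosSemidef) : 0 ≤ (A * B).trace := by
  obtain ⟨m, v, rfl⟩ := Matrix.posSemidef_iff_eq_sum_vecMulVec.mp hB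
  rw [Matrix.mul_sum, Matrix.trace_sum]
  refine Finset.sum_nonneg fun k _ => ?_
  rw [Matrix.mul_vecMulVec, Matrix.trace_vecMulVec, dotProduct_comm]
  exact hA.dotProduct_mulVec_nonneg _

theorem aux_rank_one {N : ℕ} {A : Matrix (Fin N) (Fin N) ℝ} (hA : A.PosSemidef) (h0 : A ≠ 0)
    (hm : ∀ i j, A i i * A j j - A i j ^ 2 = 0) :
    ∃ v : Fin N → ℝ, v ≠ 0 ∧ A = Matrix.vecMulVec v v := by
  have hs : ∀ i j, A j i = A i j := fun i j => by simpa using hA.isHermitian.apply i j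
  have hex : ∃ i, A i i ≠ 0 := by
    by_contra! hc
    apply h0
    ext i j
    have := hm i j
    rw [hc i] at this
    simpa using this
  obtain ⟨i, hi⟩ := hex
  have hpos : 0 < A i i := lt_of_le_of_ne (hA.diag_nonneg) (Ne.symm hi)
  have key : ∀ j k, A i i * A k j = A i j * A i k := by
    intro j k
    have hmv : ∀ l, (A.mulVec (A i i • Pi.single j 1 - A i j • Pi.single i 1)) l
        = A i i * A l j - A i j * A l i := by
      intro l
      simp [Matrix.mulVec_sub, Matrix.mulVec_smul]
    have hz : A.mulVec (A i i • Pi.single j 1 - A i j • Pi.single i 1) = 0 := by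
      rw [← hA.dotProduct_mulVec_zero_iff]
      simp only [star_trivial, sub_dotProduct, smul_dotProduct, single_dotProduct, hmv, smul_eq_mul,
        one_mul]
      rw [hs i j]
      linear_combination (A i i) * hm i j
    have := congrFun hz k
    rw [hmv, hs i k] at this
    simpa [sub_eq_zero] using this
  have hsq : Real.sqrt (A i i) * Real.sqrt (A i i) = A i i := Real.mul_self_sqrt hpos.le
  have hsp := Real.sqrt_pos.mpr hpos
  refine ⟨fun j => A i j / Real.sqrt (A i i), ?_, ?_⟩
  · intro h
    have := congrFun h i
    simp only [Pi.zero_apply] at this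
    have h2 := div_pos hpos hsp
    linarith
  · ext k j
    rw [Matrix.vecMulVec_apply, div_mul_div_comm, hsq, eq_div_iff hi]
    linarith [key j k]

theorem rank_sum_of_prf_eq_zero {N r : ℕ}
    (X : Fin r → Matrix (Fin N) (Fin N) ℝ)
    (hpsd : ∀ k, (X k).PosSemidef)
    (hne : ∀ k, X k ≠ 0)
    (hP : (∑ k, ∑ i : Fin N, ∑ j : Fin N, (X k i i * X k j j - X k i j ^ 2)) +
        ∑ p, ∑ q ∈ Finset.univ \ {p}, (X p * X q).trace = 0) :
    (∑ k, X k).PosSemidef ∧ (∑ k, X k).rank = r := by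
  refine ⟨Matrix.posSemidef_sum _ fun k _ => hpsd k, ?_⟩
  have n1 : ∀ k i j, 0 ≤ X k i i * X k j j - X k i j ^ 2 := fun k => aux_minor (hpsd k)
  have n2 : ∀ p q, 0 ≤ (X p * X q).trace := fun p q => aux_trace (hpsd p) (hpsd q)
  have N1 : 0 ≤ ∑ k, ∑ i : Fin N, ∑ j : Fin N, (X k i i * X k j j - X k i j ^ 2) :=
    Finset.sum_nonneg fun k _ => Finset.sum_nonneg fun i _ => Finset.sum_nonneg fun j _ => n1 k i j
  have N2 : 0 ≤ ∑ p, ∑ q ∈ Finset.univ \ {p}, (X p * X q).trace :=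
    Finset.sum_nonneg fun p _ => Finset.sum_nonneg fun q _ => n2 p q
  obtain ⟨z1, z2⟩ := (add_eq_zero_iff_of_nonneg N1 N2).mp hP
  have m1 : ∀ k i j, X k i i * X k j j - X k i j ^ 2 = 0 := by
    intro k i j
    have a := (Finset.sum_eq_zero_iff_of_nonneg (fun k _ => Finset.sum_nonneg fun i _ =>
      Finset.sum_nonneg fun j _ => n1 k i j)).mp z1 k (Finset.mem_univ _)
    have b := (Finset.sum_eq_zero_iff_of_nonneg (fun i _ =>
      Finset.sum_nonneg fun j _ => n1 k i j)).mp a i (Finset.mem_univ _)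
    exact (Finset.sum_eq_zero_iff_of_nonneg (fun j _ => n1 k i j)).mp b j (Finset.mem_univ _)
  have m2 : ∀ p q, p ≠ q → (X p * X q).trace = 0 := by
    intro p q hpq
    have a := (Finset.sum_eq_zero_iff_of_nonneg (fun p _ => Finset.sum_nonneg fun q _ =>
      n2 p q)).mp z2 p (Finset.mem_univ _)
    exact (Finset.sum_eq_zero_iff_of_nonneg (fun q _ => n2 p q)).mp a q (by simp [hpq.symm])
  choose v hv hX using fun k => aux_rank_one (hpsd k) (hne k) (m1 k)
  have orth : ∀ p q, p ≠ q → v p ⬝ᵥ v q = 0 := by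
    intro p q hpq
    have h := m2 p q hpq
    rw [hX p, hX q, Matrix.vecMulVec_mul_vecMulVec] at h
    simp only [Matrix.trace_vecMulVec, dotProduct_smul, smul_dotProduct, smul_eq_mul,
      MulOpposite.smul_eq_mul_unop] at h
    simpa using h
  let V : Matrix (Fin r) (Fin N) ℝ := Matrix.of v
  have hsum : ∑ k, X k = V.transpose * V := by
    ext i j
    rw [Matrix.sum_apply, Matrix.mul_apply]
    refine Finset.sum_congr rfl fun k _ => ?_
    rw [hX k]
    rfl
  have hd : V * V.transpose = Matrix.diagonal fun k => v k ⬝ᵥ v k := by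
    ext p q
    have e : (V * V.transpose) p q = v p ⬝ᵥ v q := rfl
    rw [e]
    by_cases hpq : p = q
    · subst hpq; simp
    · rw [Matrix.diagonal_apply_ne _ hpq, orth p q hpq]
  rw [hsum, Matrix.rank_transpose_mul_self, ← Matrix.rank_self_mul_transpose, hd,
    Matrix.rank_of_isUnit]
  · simp
  · rw [Matrix.isUnit_iff_isUnit_det, Matrix.det_diagonal, isUnit_iff_ne_zero]
    exact Finset.prod_ne_zero_iff.mpr fun k _ h => hv k (dotProduct_self_eq_zero.mp h)
end

section
/- Let X be an N×N real positive semidefinite matrix of rank r. Then there exist N×N real positive semidefinite matrices X^(1), …, X^(r) with X = Σ_{k=1}^{r} X^(k) such that the Particular-Rank-Functional vanishes: Σ_{k=1}^{r} L(X^(k)) + Σ_{p ≠ q} Tr(X^(p) X^(q)) = 0. -/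
theorem exists_decomposition_prf_eq_zero {N r : ℕ}
    (X : Matrix (Fin N) (Fin N) ℝ) (hX : X.PosSemidef) (hrank : X.rank = r) :
    ∃ Y : Fin r → Matrix (Fin N) (Fin N) ℝ,
      (∀ k, (Y k).PosSemidef) ∧ X = ∑ k, Y k ∧
      (∑ k, ∑ i : Fin N, ∑ j : Fin N, (Y k i i * Y k j j - Y k i j ^ 2)) +
        ∑ p, ∑ q ∈ Finset.univ \ {p}, (Y p * Y q).trace = 0 := by
  have hA := hX.isHermitian
  obtain ⟨U, hU⟩ : ∃ U : Matrix (Fin N) (Fin N) ℝ, U = hA.eigenvectorUnitary := ⟨_, rfl⟩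
  have hUU : U.transpose * U = 1 := by
    have := Unitary.coe_star_mul_self hA.eigenvectorUnitary
    rw [← hU] at this
    simpa [Matrix.star_eq_conjTranspose] using this
  have hsp : X = U * Matrix.diagonal hA.eigenvalues * U.transpose := by
    have := hA.spectral_theorem
    rw [Unitary.conjStarAlgAut_apply, ← hU] at this
    simpa [Matrix.star_eq_conjTranspose, Function.comp_def] using this
  let Z : Fin N → Matrix (Fin N) (Fin N) ℝ := fun i =>
    hA.eigenvalues i • Matrix.vecMulVec (fun a => U a i) (fun a => U a i)
  have hZ : X = ∑ i, Z i := by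
    conv_lhs => rw [hsp]
    ext a b
    rw [Matrix.mul_apply]
    simp only [Z, Matrix.mul_diagonal, Matrix.sum_apply, Matrix.smul_apply,
      Matrix.vecMulVec_apply, Matrix.transpose_apply, smul_eq_mul]
    exact Finset.sum_congr rfl fun i _ => by ring
  have hcard : Fintype.card {i // hA.eigenvalues i ≠ 0} = r := by
    rw [← hrank, hA.rank_eq_card_non_zero_eigs]
  let e : Fin r ≃ {i // hA.eigenvalues i ≠ 0} := (Fintype.equivFinOfCardEq hcard).symm
  refine ⟨fun k => Z (e k), fun k => ?_, ?_, ?_⟩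
  · have h := Matrix.posSemidef_vecMulVec_self_star (R := ℝ) (fun a => U a (e k))
    exact Matrix.PosSemidef.smul (by simpa using h) (hX.eigenvalues_nonneg _)
  · rw [Equiv.sum_comp e (fun i => Z i)]
    conv_lhs => rw [hZ]
    rw [← Finset.sum_subtype (p := fun i => hA.eigenvalues i ≠ 0)
      (Finset.univ.filter fun i => hA.eigenvalues i ≠ 0) (by simp) Z,
      Finset.sum_filter_of_ne]
    intro i _ h h0
    exact h (by simp [Z, h0])
  · rw [Finset.sum_eq_zero, Finset.sum_eq_zero, add_zero]
    · intro p _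
      refine Finset.sum_eq_zero fun q hq => ?_
      have hpq : (e p : Fin N) ≠ e q := by
        intro h
        have := e.injective (Subtype.ext h)
        simp [this] at hq
      have h0 : (fun a => U a (e p)) ⬝ᵥ (fun a => U a (e q)) = 0 := by
        have := congrFun (congrFun hUU (e p)) (e q)
        rw [Matrix.one_apply_ne hpq] at this
        exact this
      simp [Z, Matrix.vecMulVec_mul_vecMulVec, h0]
    · intro k _
      refine Finset.sum_eq_zero fun i _ => Finset.sum_eq_zero fun j _ => ?_
      simp only [Z, Matrix.smul_apply, Matrix.vecMulVec_apply, smul_eq_mul]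
      ring
end

section
/- Let X be an (M+1)×(M+1) real positive semidefinite matrix written in block form X = [[X_M, v], [vᵀ, z]]. Then L(X) = L(X_M) + 2·Σ_{i=1}^{M} (z (X_M)_{ii} − v_i²), where L denotes the Low-Rank-Functional; in particular, L(X) = 0 implies L(X_M) = 0 and z (X_M)_{ii} = v_i² for every i. -/
theorem lrf_block_decomposition {M : ℕ}
    (X : Matrix (Fin (M + 1)) (Fin (M + 1)) ℝ) (hX : X.PosSemidef) :
    (∑ i : Fin (M + 1), ∑ j : Fin (M + 1), (X i i * X j j - X i j ^ 2) =
      (∑ i : Fin M, ∑ j : Fin M,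
        (X i.castSucc i.castSucc * X j.castSucc j.castSucc -
          X i.castSucc j.castSucc ^ 2)) +
      2 * ∑ i : Fin M,
        (X (Fin.last M) (Fin.last M) * X i.castSucc i.castSucc -
          X i.castSucc (Fin.last M) ^ 2)) ∧
    (∑ i : Fin (M + 1), ∑ j : Fin (M + 1), (X i i * X j j - X i j ^ 2) = 0 →
      (∑ i : Fin M, ∑ j : Fin M,
        (X i.castSucc i.castSucc * X j.castSucc j.castSucc -
          X i.castSucc j.castSucc ^ 2)) = 0 ∧
      ∀ i : Fin M,
        X (Fin.last M) (Fin.last M) * X i.castSucc i.castSucc =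
          X i.castSucc (Fin.last M) ^ 2) := by
  have hs : ∀ i j, X i j = X j i := fun i j => by
    simpa using (hX.isHermitian.apply i j).symm
  have hm : ∀ i j, 0 ≤ X i i * X j j - X i j ^ 2 := fun i j => by
    have h := (hX.submatrix ![i, j]).det_nonneg
    rw [Matrix.det_fin_two] at h
    simp only [Matrix.submatrix_apply, Matrix.cons_val_zero, Matrix.cons_val_one] at h
    rw [hs j i] at h
    nlinarith [h]
  have key : (∑ i : Fin (M + 1), ∑ j : Fin (M + 1), (X i i * X j j - X i j ^ 2) =
      (∑ i : Fin M, ∑ j : Fin M,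
        (X i.castSucc i.castSucc * X j.castSucc j.castSucc -
          X i.castSucc j.castSucc ^ 2)) +
      2 * ∑ i : Fin M,
        (X (Fin.last M) (Fin.last M) * X i.castSucc i.castSucc -
          X i.castSucc (Fin.last M) ^ 2)) := by
    simp only [Fin.sum_univ_castSucc, Finset.sum_add_distrib]
    have e1 : ∑ i : Fin M, (X i.castSucc i.castSucc * X (Fin.last M) (Fin.last M) -
          X i.castSucc (Fin.last M) ^ 2) = ∑ i : Fin M,
        (X (Fin.last M) (Fin.last M) * X i.castSucc i.castSucc -
          X i.castSucc (Fin.last M) ^ 2) :=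
      Finset.sum_congr rfl fun i _ => by ring
    have e2 : ∑ i : Fin M, (X (Fin.last M) (Fin.last M) * X i.castSucc i.castSucc -
          X (Fin.last M) i.castSucc ^ 2) = ∑ i : Fin M,
        (X (Fin.last M) (Fin.last M) * X i.castSucc i.castSucc -
          X i.castSucc (Fin.last M) ^ 2) :=
      Finset.sum_congr rfl fun i _ => by rw [hs (Fin.last M) i.castSucc]
    rw [e1, e2]
    ring
  refine ⟨key, fun h0 => ?_⟩
  rw [key] at h0
  have n1 : 0 ≤ ∑ i : Fin M, ∑ j : Fin M,
        (X i.castSucc i.castSucc * X j.castSucc j.castSucc -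
          X i.castSucc j.castSucc ^ 2) :=
    Finset.sum_nonneg fun i _ => Finset.sum_nonneg fun j _ => hm _ _
  have hn : ∀ i ∈ (Finset.univ : Finset (Fin M)),
      0 ≤ X (Fin.last M) (Fin.last M) * X i.castSucc i.castSucc -
          X i.castSucc (Fin.last M) ^ 2 := fun i _ => by
    have h := hm i.castSucc (Fin.last M)
    linarith [mul_comm (X (Fin.last M) (Fin.last M)) (X i.castSucc i.castSucc)]
  have n2 := Finset.sum_nonneg hn
  refine ⟨by linarith, fun i => ?_⟩
  have h2 := (Finset.sum_eq_zero_iff_of_nonneg hn).1 (by linarith) i (Finset.mem_univ i)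
  linarith
end

section
/- Let A ∈ ℂ^{m×N} and b ∈ ℂᵐ. There exist angles θ_1, …, θ_N ∈ [−π, π] such that A x = b where x = (e^{iθ_1}, …, e^{iθ_N})ᵀ, if and only if there exists an (N+1)×(N+1) complex Hermitian positive semidefinite matrix X of rank one such that every diagonal entry of X equals 1 and A·X(2:N+1, 1) = b, where X(2:N+1, 1) denotes the first column of X with its first entry removed. -/
open ComplexOrder in
theorem unimodular_feasibility_iff_rank_one {m N : ℕ}
    (A : Matrix (Fin m) (Fin N) ℂ) (b : Fin m → ℂ) :
    (∃ θ : Fin N → ℝ, (∀ i, θ i ∈ Set.Icc (-Real.pi) Real.pi) ∧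
      A.mulVec (fun i => Complex.exp ((θ i : ℂ) * Complex.I)) = b) ↔
    (∃ X : Matrix (Fin (N + 1)) (Fin (N + 1)) ℂ,
      X.PosSemidef ∧ X.rank = 1 ∧
      (∀ i, X i i = 1) ∧
      A.mulVec (fun i : Fin N => X i.succ 0) = b) := by
  constructor
  · rintro ⟨θ, -, h⟩
    let v : Fin (N + 1) → ℂ := Fin.cons 1 (fun i => Complex.exp ((θ i : ℂ) * Complex.I))
    have hd : ∀ i, Matrix.vecMulVec v (star v) i i = 1 := by
      intro i
      rw [Matrix.vecMulVec_apply, Pi.star_apply, Complex.star_def, Complex.mul_conj']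
      refine Fin.cases ?_ (fun j => ?_) i
      · simp [v]
      · simp [v, Complex.norm_exp_ofReal_mul_I]
    refine ⟨Matrix.vecMulVec v (star v), Matrix.posSemidef_vecMulVec_self_star v, ?_, hd, ?_⟩
    · apply le_antisymm (Matrix.rank_vecMulVec_le _ _)
      rw [Nat.one_le_iff_ne_zero]
      intro h0
      rw [Matrix.rank, Submodule.finrank_eq_zero, LinearMap.range_eq_bot] at h0
      have h1 := congrFun (LinearMap.congr_fun h0 (Pi.single 0 1)) 0
      rw [Matrix.mulVecLin_apply, Matrix.mulVec_single_one] at h1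
      have h2 := hd 0
      simp_all
    · simpa [Matrix.vecMulVec_apply, v] using h
  · rintro ⟨X, hX, hr, hd, h⟩
    obtain ⟨v, hv⟩ := finrank_le_one_iff.mp (le_of_eq hr)
    have hc : ∀ j, ∃ c : ℂ, ∀ i, X i j = c * (v : Fin (N + 1) → ℂ) i := by
      intro j
      obtain ⟨c, hc⟩ := hv ⟨X.mulVecLin (Pi.single j 1), LinearMap.mem_range_self _ _⟩
      refine ⟨c, fun i => ?_⟩
      have := congrFun (congrArg Subtype.val hc) i
      simp [Matrix.mulVec_single_one] at this
      exact this.symm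
    choose c hc using hc
    have hn : ∀ i, ‖X i 0‖ = 1 := by
      intro i
      have h1 : X i 0 * X 0 i = X i i * X 0 0 := by
        rw [hc 0 i, hc i 0, hc i i, hc 0 0]; ring
      rw [hd, hd, ← hX.1.apply 0 i, Complex.star_def, Complex.mul_conj'] at h1
      have h2 : ‖X i 0‖ ^ 2 = 1 := by rw [mul_one] at h1; exact_mod_cast h1
      nlinarith [norm_nonneg (X i 0)]
    refine ⟨fun i => Complex.arg (X i.succ 0),
      fun i => ⟨(Complex.neg_pi_lt_arg _).le, Complex.arg_le_pi _⟩, ?_⟩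
    rw [← h]
    congr 1
    funext i
    have := Complex.norm_mul_exp_arg_mul_I (X i.succ 0)
    rwa [hn, Complex.ofReal_one, one_mul] at this
end
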